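/- arXiv:1903.07341 — 4 statements merged into one kernel-verified Lean document; each statement's English description precedes it below -/
import Mathlib

section
/- Let w : ℂ → ℝ be subharmonic and u : ℂ → ℝ be harmonic on all of ℂ. Suppose there exists Φ : ℝ → [0, ∞) such that Φ is locally bounded (bounded on every compact subset of ℝ), Φ(t)/|t| → 0 as |t| → ∞, and w(z) ≤ Φ(u(z)) for all z ∈ ℂ. Then w is constant. -/
open Complex Metric Filter Set

/-- A function `u : ℂ → ℝ` is harmonic on all of `ℂ` if it is `C²` and its Laplacian
(the sum of the second derivatives in the directions `1` and `I`) vanishes everywhere. -/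
def HarmonicFn (u : ℂ → ℝ) : Prop :=
  ContDiff ℝ 2 u ∧
    ∀ z : ℂ, iteratedFDeriv ℝ 2 u z ![1, 1] + iteratedFDeriv ℝ 2 u z ![Complex.I, Complex.I] = 0

/-- A function `u : ℂ → ℝ` is harmonic on a set `s` if it is `C²` on `s` and its Laplacian
vanishes on `s`. -/
def HarmonicOnSet (u : ℂ → ℝ) (s : Set ℂ) : Prop :=
  ContDiffOn ℝ 2 u s ∧
    ∀ z ∈ s, iteratedFDerivWithin ℝ 2 u s z ![1, 1]
      + iteratedFDerivWithin ℝ 2 u s z ![Complex.I, Complex.I] = 0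

/-- The set of asymptotic directions of a set `R ⊆ ℂ`: points `ζ` of the unit circle for which
there are `w n ∈ R` and positive `ε n → 0` with `ε n * w n → ζ`. -/
def asympDirs (R : Set ℂ) : Set ℂ :=
  {ζ : ℂ | ‖ζ‖ = 1 ∧ ∃ w : ℕ → ℂ, (∀ n, w n ∈ R) ∧ ∃ ε : ℕ → ℝ,
    (∀ n, 0 < ε n) ∧ Tendsto ε atTop (nhds 0) ∧
    Tendsto (fun n => (ε n : ℂ) * w n) atTop (nhds ζ)}

/-- `supOn u z r` is `M(u,z,r) = sup {u w : |w - z| ≤ r}`. -/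
noncomputable def supOn (u : ℂ → ℝ) (z : ℂ) (r : ℝ) : ℝ :=
  sSup (u '' Metric.closedBall z r)

/-- Subharmonic: upper semicontinuous and lies below every harmonic function dominating it on
the boundary of any disc. -/
def SubharmonicFn (w : ℂ → ℝ) : Prop :=
  UpperSemicontinuous w ∧
    ∀ (z₀ : ℂ) (r : ℝ), 0 < r → ∀ h : ℂ → ℝ,
      HarmonicOnSet h (Metric.ball z₀ r) → ContinuousOn h (Metric.closedBall z₀ r) →
      (∀ ζ ∈ Metric.sphere z₀ r, w ζ ≤ h ζ) → ∀ ζ ∈ Metric.closedBall z₀ r, w ζ ≤ h ζ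

open InnerProductSpace

theorem HarmonicFn.harmonicOnNhd {u : ℂ → ℝ} (hu : HarmonicFn u) (s : Set ℂ) :
    HarmonicOnNhd u s := fun _ _ => by
  refine ⟨hu.1.contDiffAt, Eventually.of_forall fun z => ?_⟩
  rw [laplacian_eq_iteratedFDeriv_complexPlane]
  exact hu.2 z

theorem HarmonicOnSet.of_harmonicOnNhd {g : ℂ → ℝ} {s : Set ℂ} (hs : IsOpen s)
    (hg : HarmonicOnNhd g s) : HarmonicOnSet g s := by
  refine ⟨hg.contDiffOn, fun z hz => ?_⟩
  rw [iteratedFDerivWithin_of_isOpen 2 hs hz]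
  simpa [laplacian_eq_iteratedFDeriv_complexPlane] using (hg z hz).2.self_of_nhds

/-- Adding `η‖z‖²` to the difference of a subharmonic and a harmonic function makes it strictly
subharmonic, so that it has no interior maximum. -/
theorem SubharmonicFn.exists_lt_of_harmonicOnNhd {w g : ℂ → ℝ} (hw : SubharmonicFn w) {U : Set ℂ}
    (hU : IsOpen U) (hg : HarmonicOnNhd g U) {η : ℝ} (hη : 0 < η) {z₀ : ℂ} (hz₀ : z₀ ∈ U) :
    ∃ z ∈ U, w z₀ - g z₀ + η * ‖z₀‖ ^ 2 < w z - g z + η * ‖z‖ ^ 2 := by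
  by_contra! hmax
  obtain ⟨ρ, hρ, hball⟩ := nhds_basis_closedBall.mem_iff.1 (hU.mem_nhds hz₀)
  let F : ℂ → ℂ := fun z =>
    ((w z₀ - g z₀ - η * ρ ^ 2 : ℝ) : ℂ) - ((2 * η : ℝ) : ℂ) * ((z - z₀) * (starRingEnd ℂ) z₀)
  have hF : ∀ z, AnalyticAt ℂ F z := fun z => by fun_prop
  let h : ℂ → ℝ := g + fun z => (F z).re
  have hh : HarmonicOnNhd h (closedBall z₀ ρ) := fun z hz =>
    (hg z (hball hz)).add (hF z).harmonicAt_re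
  have key := hw.2 z₀ ρ hρ h
    (.of_harmonicOnNhd isOpen_ball (hh.mono ball_subset_closedBall)) hh.continuousOn ?_ z₀
    (mem_closedBall_self hρ.le)
  · have : h z₀ = w z₀ - η * ρ ^ 2 := by
      simp [h, F, -ofReal_pow]
      ring
    have : 0 < η * ρ ^ 2 := by positivity
    linarith
  · intro z hz
    have h1 := hmax z (hball (sphere_subset_closedBall hz))
    have h2 : ‖z - z₀‖ ^ 2 = ρ ^ 2 := by rw [mem_sphere_iff_norm.1 hz]
    have h3 : h z = g z + (w z₀ - g z₀ - η * ρ ^ 2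
        - 2 * η * ((z.re - z₀.re) * z₀.re + (z.im - z₀.im) * z₀.im)) := by
      simp [h, F, -ofReal_pow]
    rw [h3, ← h2]
    simp only [Complex.sq_norm, normSq_apply, sub_re, sub_im] at h1 ⊢
    linarith

/-- Maximum principle on bounded open sets. -/
theorem SubharmonicFn.le_of_le_on_frontier {w g : ℂ → ℝ} (hw : SubharmonicFn w) {U : Set ℂ}
    (hU : IsOpen U) (hb : Bornology.IsBounded U) (hg : HarmonicOnNhd g U)
    (hgc : ContinuousOn g (closure U)) (hfr : ∀ z ∈ frontier U, w z ≤ g z) :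
    ∀ z ∈ U, w z ≤ g z := by
  intro p hp
  by_contra! hlt
  obtain ⟨R, hR⟩ := hb.closure.exists_norm_le
  obtain ⟨η, hη, hηR⟩ : ∃ η > 0, η * R ^ 2 < w p - g p := by
    refine ⟨(w p - g p) / (R ^ 2 + 1), div_pos (by linarith) (by positivity), ?_⟩
    rw [div_mul_eq_mul_div, div_lt_iff₀ (by positivity)]
    nlinarith
  have husc : UpperSemicontinuousOn (fun z => w z + (- g z + η * ‖z‖ ^ 2)) (closure U) := by
    refine (hw.1.upperSemicontinuousOn _).add (ContinuousOn.upperSemicontinuousOn ?_)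
    fun_prop
  obtain ⟨z₀, hz₀, hmax⟩ :=
    husc.exists_isMaxOn ⟨p, subset_closure hp⟩ hb.isCompact_closure
  have hpz := hmax (subset_closure hp)
  simp only [mem_ofPred_eq] at hpz
  by_cases hzU : z₀ ∈ U
  · obtain ⟨z, hz, hlt'⟩ := hw.exists_lt_of_harmonicOnNhd hU hg hη hzU
    have := hmax (subset_closure hz)
    simp only [mem_ofPred_eq] at this
    linarith
  · have h1 := hfr z₀ ⟨hz₀, by rwa [hU.interior_eq]⟩
    have h2 : η * ‖z₀‖ ^ 2 ≤ η * R ^ 2 := by gcongr; exact hR z₀ hz₀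
    have h3 : 0 ≤ η * ‖p‖ ^ 2 := by positivity
    linarith

/-- Phragmén–Lindelöf principle on open sets whose closure omits a disc. -/
theorem SubharmonicFn.le_of_le_on_frontier_of_le_add {w g : ℂ → ℝ} (hw : SubharmonicFn w)
    {U : Set ℂ} (hU : IsOpen U) {a : ℂ} {r : ℝ} (hr : 0 < r)
    (hUr : ∀ z ∈ closure U, r ≤ ‖z - a‖) (hg : HarmonicOnNhd g U)
    (hgc : ContinuousOn g (closure U)) (hfr : ∀ z ∈ frontier U, w z ≤ g z)
    {C : ℝ} (hC : ∀ z ∈ U, w z ≤ g z + C) :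
    ∀ z ∈ U, w z ≤ g z := by
  intro p hp
  let L : ℂ → ℝ := fun z => Real.log ‖z - a‖ - Real.log r
  have hL : ∀ z ∈ closure U, HarmonicAt L z := fun z hz =>
    HarmonicAt.sub (AnalyticAt.harmonicAt_log_norm (f := fun z => z - a) (by fun_prop)
      (norm_pos_iff.1 (hr.trans_le (hUr z hz)))) (harmonicAt_const _)
  have hL0 : ∀ z ∈ closure U, 0 ≤ L z := fun z hz =>
    sub_nonneg.2 (Real.log_le_log hr (hUr z hz))
  have main : ∀ δ > 0, w p ≤ g p + δ * L p := by
    intro δ hδ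
    obtain ⟨R, hRC, hpR⟩ := ((Real.tendsto_log_atTop.eventually_ge_atTop
      (C / δ + Real.log r)).and (eventually_gt_atTop ‖p - a‖)).exists
    have hCR : C ≤ δ * (Real.log R - Real.log r) := by
      rw [← div_le_iff₀' hδ]
      linarith
    have hcl : closure (U ∩ ball a R) ⊆ closure U := closure_mono inter_subset_left
    refine hw.le_of_le_on_frontier (g := g + δ • L) (hU.inter isOpen_ball)
      (isBounded_ball.subset inter_subset_right) ?_ ?_ ?_ p ⟨hp, mem_ball_iff_norm.2 hpR⟩
    · exact fun z hz => (hg z hz.1).add (hL z (subset_closure hz.1)).const_smul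
    · have hLc : ContinuousOn L (closure U) := HarmonicOnNhd.continuousOn hL
      exact (hgc.add (hLc.const_smul δ)).mono hcl
    · intro z hz
      have hzU := hcl hz.1
      have hLz : 0 ≤ δ * L z := mul_nonneg hδ.le (hL0 z hzU)
      simp only [Pi.add_apply, Pi.smul_apply, smul_eq_mul]
      by_cases hzU' : z ∈ U
      · rcases frontier_inter_subset _ _ hz with h | h
        · exact absurd hzU' (by simpa [hU.interior_eq] using h.1.2)
        · have : L z = Real.log R - Real.log r := by
            simp only [L, mem_sphere_iff_norm.1 (frontier_ball_subset_sphere h.2)]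
          rw [this]
          linarith [hC z hzU']
      · have := hfr z ⟨hzU, by rwa [hU.interior_eq]⟩
        linarith
  have hlim : Tendsto (fun δ : ℝ => g p + δ * L p) (nhdsWithin 0 (Ioi 0)) (nhds (g p)) := by
    have : Continuous fun δ : ℝ => g p + δ * L p := by fun_prop
    simpa using (this.tendsto 0).mono_left nhdsWithin_le_nhds
  exact ge_of_tendsto hlim (eventually_mem_nhdsWithin.mono main)

/-- Liouville's theorem for subharmonic functions bounded above. -/
theorem SubharmonicFn.eq_of_bddAbove {w : ℂ → ℝ} (hw : SubharmonicFn w) {M : ℝ}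
    (hM : ∀ z, w z ≤ M) (z a : ℂ) : w z = w a := by
  suffices H : ∀ z a, w z ≤ w a from le_antisymm (H z a) (H a z)
  intro z a
  refine le_of_forall_pos_le_add fun η hη => ?_
  obtain ⟨r, hr, hball⟩ := nhds_basis_closedBall.mem_iff.1
    (hw.1 a (w a + η) (by linarith))
  by_cases hz : z ∈ closedBall a r
  · exact (hball hz).le
  · have hcl : closure (closedBall a r)ᶜ ⊆ {z | r ≤ ‖z - a‖} := by
      refine closure_minimal (fun y hy => ?_) (isClosed_le (by fun_prop) (by fun_prop))
      simpa [dist_eq_norm] using (lt_of_not_ge (mem_closedBall.not.1 hy)).le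
    refine hw.le_of_le_on_frontier_of_le_add (g := fun _ => w a + η) (C := M - (w a + η))
      isClosed_closedBall.isOpen_compl hr hcl (harmonicOnNhd_const _) continuousOn_const
      (fun y hy => ?_) (fun y _ => by linarith [hM y]) z hz
    rw [frontier_compl] at hy
    exact (hball (isClosed_closedBall.frontier_subset hy)).le

/-- If `w ≤ C + ε|u|` for every `ε > 0`, then `w` is bounded on `{u > t}` by its bound
on the level set `{u = t}`, provided that `u` takes a value below `t`. -/
theorem SubharmonicFn.le_of_le_on_level {w u : ℂ → ℝ} (hw : SubharmonicFn w)
    (hu : HarmonicOnNhd u univ) {t m : ℝ} (hlevel : ∀ z, u z = t → w z ≤ m)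
    (hgrowth : ∀ ε > 0, ∃ C, ∀ z, w z ≤ C + ε * |u z|) {a : ℂ} (ha : u a < t) {z : ℂ}
    (hz : t < u z) : w z ≤ m := by
  have huc : Continuous u := continuousOn_univ.1 hu.continuousOn
  obtain ⟨r, hr, hball⟩ := isOpen_iff.1 (isOpen_lt huc continuous_const) a ha
  have hcl : closure {z | t < u z} ⊆ {z | t ≤ u z} :=
    closure_minimal (ofPred_subset_ofPred.2 fun _ => le_of_lt) (isClosed_le continuous_const huc)
  have main : ∀ ε > 0, w z ≤ m + ε * (u z - t) := by
    intro ε hε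
    obtain ⟨C, hC⟩ := hgrowth ε hε
    refine hw.le_of_le_on_frontier_of_le_add (g := (fun _ => m) + ε • (u - fun _ => t))
      (C := C + 2 * ε * |t| - m) (isOpen_lt continuous_const huc) hr (a := a) ?_ ?_ ?_ ?_ ?_ z hz
    · intro y hy
      by_contra! hlt
      have hlow : u y < t := hball (mem_ball_iff_norm.2 hlt)
      have hhigh : t ≤ u y := hcl hy
      exact hhigh.not_gt hlow
    · exact fun y _ => (harmonicAt_const _).add
        ((hu y trivial).sub (harmonicAt_const _)).const_smul
    · exact (continuous_const.add ((huc.sub continuous_const).const_smul ε)).continuousOn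
    · intro y hy
      have : t = u y := frontier_lt_subset_eq continuous_const huc hy
      simpa [← this] using hlevel y this.symm
    · intro y hy
      have h1 := hC y
      have h2 : |u y| ≤ u y - t + 2 * |t| := by
        have hy' : t < u y := hy
        rw [abs_le]
        constructor <;> linarith [neg_abs_le t, le_abs_self t, abs_nonneg t]
      have h3 := mul_le_mul_of_nonneg_left h2 hε.le
      simp only [Pi.add_apply, Pi.smul_apply, Pi.sub_apply, smul_eq_mul]
      linarith
  have hlim : Tendsto (fun ε : ℝ => m + ε * (u z - t)) (nhdsWithin 0 (Ioi 0)) (nhds m) := by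
    have : Continuous fun ε : ℝ => m + ε * (u z - t) := by fun_prop
    simpa using (this.tendsto 0).mono_left nhdsWithin_le_nhds
  exact ge_of_tendsto hlim (eventually_mem_nhdsWithin.mono main)

theorem exists_le_add_mul_abs_of_tendsto_div_abs {Φ : ℝ → ℝ}
    (hloc : ∀ K : Set ℝ, IsCompact K → ∃ M : ℝ, ∀ t ∈ K, Φ t ≤ M)
    (hasy : Tendsto (fun t => Φ t / |t|) (cocompact ℝ) (nhds 0)) {ε : ℝ} (hε : 0 < ε) :
    ∃ C, ∀ t, Φ t ≤ C + ε * |t| := by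
  obtain ⟨K, hK, hKε⟩ := mem_cocompact.1 (hasy.eventually_lt_const hε)
  obtain ⟨M, hM⟩ := hloc (insert 0 K) (hK.insert 0)
  refine ⟨max M 0, fun t => ?_⟩
  by_cases ht : t ∈ insert 0 K
  · have : 0 ≤ ε * |t| := by positivity
    linarith [hM t ht, le_max_left M 0]
  · rw [mem_insert_iff, not_or] at ht
    have : Φ t / |t| < ε := hKε ht.2
    rw [div_lt_iff₀ (abs_pos.2 ht.1)] at this
    linarith [le_max_right M 0]

/-- **Theorem (subharmonic version of Theorem 2).** If `w` is subharmonic, `u` is harmonic,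
`Φ : ℝ → [0,∞)` is locally bounded with `Φ(t)/|t| → 0` as `|t| → ∞`, and `w ≤ Φ ∘ u`,
then `w` is constant. -/
theorem subharmonic_dominated_implies_constant
    (w u : ℂ → ℝ) (hw : SubharmonicFn w) (hu : HarmonicFn u)
    (Φ : ℝ → ℝ) (hΦ0 : ∀ t, 0 ≤ Φ t)
    (hloc : ∀ K : Set ℝ, IsCompact K → ∃ M : ℝ, ∀ t ∈ K, Φ t ≤ M)
    (hasy : Tendsto (fun t => Φ t / |t|) (cocompact ℝ) (nhds 0))
    (hwu : ∀ z, w z ≤ Φ (u z)) :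
    ∃ c : ℝ, ∀ z, w z = c := by
  have hu' := hu.harmonicOnNhd univ
  have hgrowth : ∀ ε > 0, ∃ C, ∀ z, w z ≤ C + ε * |u z| := fun ε hε =>
    (exists_le_add_mul_abs_of_tendsto_div_abs hloc hasy hε).imp
      fun C hC z => (hwu z).trans (hC _)
  suffices H : ∃ M, ∀ z, w z ≤ M from
    H.elim fun M hM => ⟨w 0, fun z => hw.eq_of_bddAbove hM z 0⟩
  by_cases hconst : ∀ z, u z = u 0
  · exact ⟨Φ (u 0), fun z => hconst z ▸ hwu z⟩
  obtain ⟨t, ⟨a, ha⟩, ⟨b, hb⟩⟩ : ∃ t, (∃ a, u a < t) ∧ ∃ b, t < u b := by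
    push Not at hconst
    obtain ⟨z, hz⟩ := hconst
    rcases hz.lt_or_gt with h | h
    · exact (exists_between h).imp fun t ht => ⟨⟨z, ht.1⟩, 0, ht.2⟩
    · exact (exists_between h).imp fun t ht => ⟨⟨0, ht.1⟩, z, ht.2⟩
  refine ⟨Φ t, fun z => ?_⟩
  rcases lt_trichotomy (u z) t with h | h | h
  · refine hw.le_of_le_on_level (u := -u) (t := -t) (a := b) hu'.neg (fun y hy => ?_) ?_
      (neg_lt_neg hb) (neg_lt_neg h)
    · exact neg_injective hy ▸ hwu y
    · simpa using hgrowth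
  · exact h ▸ hwu z
  · exact hw.le_of_le_on_level hu' (fun y hy => hy ▸ hwu y) hgrowth ha h
end

section
/- Let u, v : ℂ → ℝ be harmonic functions and C > 0 a constant such that |u⁺(z) − v⁺(z)| ≤ C and max(u(z), v(z)) ≥ −C for every z ∈ ℂ, where t⁺ = max(t, 0). Then u and v are constant. -/
open Complex Metric Filter Set

/-- A harmonic function on the plane is the real part of an entire function. -/
theorem HarmonicFn.exists_entire_re_eq {u : ℂ → ℝ} (hu : HarmonicFn u) :
    ∃ F : ℂ → ℂ, Differentiable ℂ F ∧ ∀ z, (F z).re = u z := by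
  have h : InnerProductSpace.HarmonicOnNhd u univ := fun z _ =>
    ⟨hu.1.contDiffAt, Eventually.of_forall fun x => by
      simpa [InnerProductSpace.laplacian_eq_iteratedFDeriv_complexPlane] using hu.2 x⟩
  obtain ⟨F, hF, hFu⟩ := h.exists_analyticOnNhd_univ_re_eq
  exact ⟨F, fun z => (hF z (mem_univ z)).differentiableAt, congrFun hFu⟩

/-- **Liouville's theorem** for an entire function whose real part is bounded above. -/
theorem re_eq_const_of_forall_re_le {F : ℂ → ℂ} (hF : Differentiable ℂ F) {T : ℝ}
    (hT : ∀ z, (F z).re ≤ T) : ∃ c : ℝ, ∀ z, (F z).re = c := by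
  have hb : Bornology.IsBounded (range fun z => exp (F z)) := by
    refine isBounded_iff_forall_norm_le.2 ⟨Real.exp T, ?_⟩
    rintro _ ⟨z, rfl⟩
    simpa [norm_exp] using hT z
  refine ⟨(F 0).re, fun z => Real.exp_injective ?_⟩
  have := hF.cexp.apply_eq_apply_of_bounded hb z 0
  simpa [norm_exp] using congrArg norm this

/-- **Harnack's inequality** for a positive harmonic function on a disc of radius `2 * ρ`. -/
theorem re_le_three_mul_of_forall_ball_re_pos {F : ℂ → ℂ} (hF : Differentiable ℂ F) {x y : ℂ}
    {ρ : ℝ} (hρ : 0 < ρ) (hpos : ∀ z ∈ ball y (2 * ρ), 0 < (F z).re) (hxy : dist x y ≤ ρ) :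
    (F x).re ≤ 3 * (F y).re := by
  have hy : 0 < (F y).re := hpos y (mem_ball_self (by positivity))
  have hn : ‖x - y‖ ≤ ρ := by rwa [← dist_eq_norm]
  have key := borelCaratheodory_zero (f := fun w => F y - F (y + w)) (z := x - y) (R := 2 * ρ) hy
    (by fun_prop)
    (fun w hw => by
      have := hpos (y + w) (by simpa using hw)
      simp only [mem_ofPred_eq, sub_re]; linarith)
    (by positivity) (by rw [mem_ball_zero_iff]; linarith) (by simp)
  have h2 : 2 * (F y).re * ‖x - y‖ / (2 * ρ - ‖x - y‖) ≤ 2 * (F y).re := by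
    rw [div_le_iff₀ (by linarith)]
    nlinarith
  have h3 := neg_abs_le (F y - F (y + (x - y))).re
  have h4 := abs_re_le_norm (F y - F (y + (x - y)))
  simp only [add_sub_cancel, sub_re] at *
  linarith

/-- If every value of a harmonic function within distance `s` of a zero in `ball a (2 * D)` is at
most `A`, then a chain of discs from a zero `a` bounds the function on a larger disc around `a`. -/
theorem re_le_of_forall_re_le_near_zeros {F : ℂ → ℂ} (hF : Differentiable ℂ F) {a : ℂ}
    {s D A : ℝ} (hs : 0 < s) (hsD : s ≤ D) (hA : 0 ≤ A) (ha : (F a).re = 0)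
    (hzero : ∀ b ∈ ball a (2 * D), (F b).re = 0 → ∀ x, dist x b ≤ s → (F x).re ≤ A) (n : ℕ) :
    ∀ x, dist x a < D → dist x a ≤ n * (s / 4) → (F x).re ≤ 3 ^ n * A := by
  have hcont : Continuous fun z => (F z).re := continuous_re.comp hF.continuous
  induction n with
  | zero =>
    intro x _ hx
    have : x = a := by simpa using hx
    simp [this, ha, hA]
  | succ n ih =>
    intro x hxD hx
    have hmono : A ≤ 3 ^ (n + 1) * A := le_mul_of_one_le_left hA (one_le_pow₀ (by norm_num))
    by_cases hb : ∃ b ∈ ball x s, (F b).re = 0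
    · obtain ⟨b, hbx, hb0⟩ := hb
      rw [mem_ball] at hbx
      refine (hzero b ?_ hb0 x (by rw [dist_comm]; exact hbx.le)).trans hmono
      have := dist_triangle b x a
      rw [mem_ball]; linarith
    push Not at hb
    rcases le_or_gt (F x).re 0 with hx0 | hx0
    · exact hx0.trans (by positivity)
    have hpos : ∀ z ∈ ball x s, 0 < (F z).re := by
      intro z hz
      by_contra! hz0
      obtain ⟨b, hbx, hb0⟩ := (convex_ball x s).isPreconnected.intermediate_value hz
        (mem_ball_self hs) hcont.continuousOn ⟨hz0, hx0.le⟩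
      exact hb b hbx hb0
    set t : ℝ := n / (n + 1) with ht
    have hn : (0 : ℝ) < n + 1 := by positivity
    have ht0 : 0 ≤ t := by positivity
    have ht1 : t ≤ 1 := by rw [ht, div_le_one hn]; linarith
    set y : ℂ := a + t * (x - a) with hy
    have hya : dist y a = t * dist x a := by
      simp [hy, dist_eq_norm, abs_of_nonneg ht0]
    have hxy : dist x y = (1 - t) * dist x a := by
      have : x - y = ((1 - t : ℝ) : ℂ) * (x - a) := by push_cast [hy]; ring
      rw [dist_eq_norm, this, norm_mul, norm_real, Real.norm_of_nonneg (by linarith), dist_eq_norm]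
    have hd : dist x a / (n + 1) ≤ s / 4 := by
      rw [div_le_iff₀ hn]; push_cast at hx; linarith
    have hxy' : dist x y ≤ s / 4 := by
      rw [hxy, ht]
      convert hd using 1
      field_simp; ring
    have hya' : dist y a ≤ n * (s / 4) := by
      rw [hya, ht, div_mul_eq_mul_div, mul_div_assoc]
      gcongr
    have hyD : dist y a < D := by
      rw [hya]
      exact (mul_le_of_le_one_left dist_nonneg ht1).trans_lt hxD
    have := re_le_three_mul_of_forall_ball_re_pos hF (x := x) (y := y) (ρ := s / 4) (by positivity)
      (fun z hz => hpos z (by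
        rw [mem_ball] at *
        have := dist_triangle z y x
        rw [dist_comm y x] at this
        linarith)) hxy'
    rw [pow_succ]
    linarith [ih y hyD hya']

/-- **Lewis' lemma**: a harmonic function with a zero, unbounded above, satisfies a uniform
doubling condition on suitable discs centred at zeros, on which it is arbitrarily large. -/
theorem exists_re_doubling {F : ℂ → ℂ} (hF : Differentiable ℂ F) {a₀ : ℂ}
    (h0 : (F a₀).re = 0) (hub : ∀ T : ℝ, ∃ p, T ≤ (F p).re) {T : ℝ} (hT : 0 < T) :
    ∃ a c : ℂ, (F a).re = 0 ∧ T ≤ (F (a + c)).re ∧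
      ∀ w : ℂ, ‖w‖ < 8 → (F (a + c * w)).re ≤ 3 ^ 64 * (2 * (F (a + c)).re) := by
  obtain ⟨p, hp⟩ := hub T
  set R : ℝ := 32 * dist p a₀ + 1 with hR
  have hR0 : 0 < R := by positivity
  let P : Set (ℂ × ℂ) := {q | (F q.1).re = 0 ∧ dist q.1 a₀ < R ∧
    dist q.2 q.1 ≤ (R - dist q.1 a₀) / 32}
  have hpP : (a₀, p) ∈ P := ⟨h0, by simpa using hR0, by simp [hR]; linarith⟩
  have hbdd : BddAbove ((fun q : ℂ × ℂ => (F q.2).re) '' P) := by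
    have hK := ((isCompact_closedBall a₀ (2 * R)).image
      (continuous_re.comp hF.continuous)).bddAbove
    refine hK.mono ?_
    rintro _ ⟨⟨b, x⟩, ⟨-, hb, hx⟩, rfl⟩
    refine ⟨x, ?_, rfl⟩
    rw [mem_closedBall]
    have := dist_triangle x b a₀
    have := dist_nonneg (x := b) (y := a₀)
    simp only at hb hx
    linarith
  obtain ⟨⟨a, z⟩, ⟨ha, haR, hz⟩, hTz, hmax⟩ :
      ∃ q ∈ P, T ≤ (F q.2).re ∧ ∀ q' ∈ P, (F q'.2).re ≤ 2 * (F q.2).re := by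
    have hS : T ≤ sSup ((fun q : ℂ × ℂ => (F q.2).re) '' P) :=
      hp.trans (le_csSup hbdd ⟨_, hpP, rfl⟩)
    by_cases hcase : ∀ q' ∈ P, (F q'.2).re ≤ 2 * (F p).re
    · exact ⟨_, hpP, hp, hcase⟩
    push Not at hcase
    obtain ⟨q₁, hq₁, hlt₁⟩ := hcase
    obtain ⟨_, ⟨q, hq, rfl⟩, hlt⟩ := exists_lt_of_lt_csSup (Set.Nonempty.image _ ⟨_, hpP⟩)
      (half_lt_self (hT.trans_le hS))
    have h₁ := le_csSup hbdd ⟨q₁, hq₁, rfl⟩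
    simp only at hlt h₁
    refine ⟨q, hq, by linarith, fun q' hq' => ?_⟩
    have h' := le_csSup hbdd ⟨q', hq', rfl⟩
    simp only at h'
    linarith
  simp only at ha haR hz hTz hmax
  set d : ℝ := R - dist a a₀ with hd
  have hd0 : 0 < d := by linarith
  refine ⟨a, z - a, ha, by simpa using hTz, fun w hw => ?_⟩
  rw [add_sub_cancel]
  have hne : 0 < dist z a := dist_pos.2 fun h => by rw [h] at hTz; linarith
  have hdist : dist (a + (z - a) * w) a < d / 4 := by
    rw [dist_eq_norm, add_sub_cancel_left, norm_mul, ← dist_eq_norm]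
    nlinarith
  refine re_le_of_forall_re_le_near_zeros hF (s := d / 64) (D := d / 4) (by positivity) (by linarith)
    (by linarith) ha ?_ 64 _ hdist (by push_cast; linarith)
  intro b hb hb0 x hx
  rw [mem_ball] at hb
  have := dist_triangle b a a₀
  exact hmax (b, x) ⟨hb0, by simp only; linarith, by simp only; linarith⟩

/-- **Montel's theorem** along an ultrafilter. -/
theorem exists_tendstoLocallyUniformlyOn_of_norm_le {ι : Type*} (l : Ultrafilter ι)
    {F : ι → ℂ → ℂ} {U : Set ℂ} (hU : IsOpen U) {M : ℝ}
    (hF : ∀ i, DifferentiableOn ℂ (F i) U) (hM : ∀ i, ∀ z ∈ U, ‖F i z‖ ≤ M) :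
    ∃ f : ℂ → ℂ, DifferentiableOn ℂ f U ∧ TendstoLocallyUniformlyOn F f l U := by
  have hlim : ∀ z, ∃ y, z ∈ U → Tendsto (fun i => F i z) l (nhds y) := by
    intro z
    by_cases hz : z ∈ U
    · obtain ⟨y, -, hy⟩ := (isCompact_closedBall (0 : ℂ) M).ultrafilter_le_nhds
        (l.map fun i => F i z) (by
          rw [le_principal_iff, Ultrafilter.coe_map, mem_map]
          exact Eventually.of_forall fun i => by simpa using hM i z hz)
      exact ⟨y, fun _ => hy⟩
    · exact ⟨0, fun h => absurd h hz⟩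
  choose f hf using hlim
  have hloc : TendstoLocallyUniformlyOn F f l U := by
    rw [Metric.tendstoLocallyUniformlyOn_iff]
    intro ε hε z₀ hz₀
    obtain ⟨ρ, hρ, hρU⟩ := Metric.isOpen_iff.1 hU z₀ hz₀
    have hM0 : 0 ≤ M := by
      obtain ⟨i⟩ := l.nonempty_of_neBot
      exact (norm_nonneg _).trans (hM i z₀ hz₀)
    have hlip : ∀ i, ∀ z ∈ ball z₀ ρ, dist (F i z) (F i z₀) ≤ 2 * M / ρ * dist z z₀ := by
      intro i z hz
      refine dist_le_div_mul_dist_of_mapsTo_ball ((hF i).mono hρU) (fun w hw => ?_) hz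
      rw [mem_closedBall, dist_eq_norm]
      linarith [norm_sub_le (F i w) (F i z₀), hM i w (hρU hw), hM i z₀ hz₀]
    have hlip' : ∀ z ∈ ball z₀ ρ, dist (f z) (f z₀) ≤ 2 * M / ρ * dist z z₀ := fun z hz =>
      le_of_tendsto ((hf z (hρU hz)).dist (hf z₀ hz₀)) (Eventually.of_forall fun i => hlip i z hz)
    obtain ⟨δ, hδ, hδε⟩ : ∃ δ > 0, 2 * M / ρ * δ < ε / 3 := by
      refine ⟨ε / 3 / (2 * M / ρ + 1), by positivity, ?_⟩
      rw [mul_div_assoc', div_lt_iff₀ (by positivity)]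
      nlinarith
    refine ⟨ball z₀ (min δ ρ), mem_nhdsWithin_of_mem_nhds (ball_mem_nhds _ (lt_min hδ hρ)), ?_⟩
    filter_upwards [(hf z₀ hz₀).eventually (ball_mem_nhds _ (by positivity : 0 < ε / 3))]
      with i hi z hz
    have hzρ : z ∈ ball z₀ ρ := ball_subset_ball (min_le_right _ _) hz
    have hzδ : 2 * M / ρ * dist z z₀ ≤ 2 * M / ρ * δ := by
      gcongr
      exact ((mem_ball.1 hz).trans_le (min_le_left _ _)).le
    have h1 := hlip i z hzρ
    have h2 := hlip' z hzρ
    have h3 := dist_triangle4 (f z) (f z₀) (F i z₀) (F i z)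
    rw [dist_comm (f z₀), dist_comm (F i z₀) (F i z)] at h3
    linarith
  exact ⟨f, hloc.differentiableOn (Eventually.of_forall hF) hU, hloc⟩

/-- The limiting configuration in Lewis' theorem is contradictory. -/
theorem false_of_max_re_eq {f g : ℂ → ℂ} {U : Set ℂ} (hU : IsOpen U) (hUc : IsConnected U)
    (hf : DifferentiableOn ℂ f U) (hg : DifferentiableOn ℂ g U)
    (heq : ∀ z ∈ U, max (f z).re 0 = max (g z).re 0)
    (hnn : ∀ z ∈ U, 0 ≤ max (f z).re (g z).re)
    {p q : ℂ} (hp : p ∈ U) (hq : q ∈ U) (hp0 : (f p).re = 0) (hq0 : 0 < (f q).re) : False := by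
  have hfa := hf.analyticOnNhd hU
  have hga := hg.analyticOnNhd hU
  have hV : ∀ᶠ z in nhds q, (f z - g z).re = 0 := by
    filter_upwards [(continuous_re.continuousAt.comp (hfa q hq).continuousAt).eventually
      (lt_mem_nhds hq0), hU.mem_nhds hq] with z hz hzU
    have := heq z hzU
    simp only [Function.comp_apply] at hz
    rw [max_eq_left hz.le] at this
    rcases max_choice (g z).re 0 with h | h <;> rw [h] at this <;> simp <;> linarith
  obtain ⟨ρ, hρ, hρV⟩ := Metric.eventually_nhds_iff_ball.1 hV
  obtain ⟨r, hr, hrU⟩ := Metric.isOpen_iff.1 hU q hq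
  have hconn : IsConnected (ball q (min ρ r)) :=
    (convex_ball _ _).isConnected (nonempty_ball.2 (lt_min hρ hr))
  obtain ⟨c, hc⟩ := AnalyticOnNhd.eq_const_of_re_eq_const (c₀ := 0)
    ((hfa.sub hga).mono ((ball_subset_ball (min_le_right ρ r)).trans hrU))
    (fun z hz => hρV z (ball_subset_ball (min_le_left _ _) hz)) isOpen_ball hconn
  have hqc : q ∈ ball q (min ρ r) := mem_ball_self (lt_min hρ hr)
  have hEq := (hfa.sub hga).eqOn_of_preconnected_of_eventuallyEq (analyticOnNhd_const (v := c))
    hUc.isPreconnected hq (Filter.mem_of_superset (isOpen_ball.mem_nhds hqc) hc)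
  have hc0 : c.re = 0 := by
    rw [← hc q hqc]
    exact hρV q (mem_ball_self hρ)
  have hfnn : ∀ z ∈ U, 0 ≤ (f z).re := by
    intro z hz
    have h1 : (f z).re = (g z).re := by
      have := congrArg re (hEq hz)
      simp only [Pi.sub_apply, sub_re, hc0] at this
      linarith
    simpa [← h1] using hnn z hz
  rcases hfa.is_constant_or_isOpen hUc.isPreconnected with ⟨w, hw⟩ | hopen
  · rw [hw q hq, ← hw p hp, hp0] at hq0
    exact hq0.false
  · have := isOpenMap_re _ (hopen U subset_rfl hU)
    obtain ⟨ε, hε, hball⟩ := Metric.isOpen_iff.1 this 0 ⟨f p, ⟨p, hp, rfl⟩, hp0⟩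
    obtain ⟨_, ⟨z, hz, rfl⟩, hzr⟩ := hball (show -(ε / 2) ∈ ball (0 : ℝ) ε by
      rw [mem_ball_zero_iff, norm_neg, Real.norm_of_nonneg (by positivity)]; linarith)
    linarith [hfnn z hz]

/-- A bound for an entire function on a disc in terms of its value at a nearby point `p` and an
upper bound for its real part. -/
theorem norm_le_of_forall_ball_re_le {f : ℂ → ℂ} (hf : Differentiable ℂ f) {p z : ℂ} {M : ℝ}
    (hM : 0 < M) (hre : ∀ w ∈ ball p 4, (f w).re ≤ M) (hp : ‖f p‖ ≤ M) (hz : dist z p ≤ 3) :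
    ‖f z‖ ≤ 13 * M := by
  have hn : ‖z - p‖ ≤ 3 := by rwa [← dist_eq_norm]
  have key := borelCaratheodory (f := fun w => f (p + w)) (z := z - p) (R := 4) hM (by fun_prop)
    (fun w hw => hre (p + w) (by simpa using hw)) (by norm_num)
    (by rw [mem_ball_zero_iff]; linarith)
  simp only [add_sub_cancel, add_zero] at key
  refine key.trans ?_
  calc 2 * M * ‖z - p‖ / (4 - ‖z - p‖) + ‖f p‖ * (4 + ‖z - p‖) / (4 - ‖z - p‖)
      ≤ 2 * M * 3 / (4 - 3) + M * (4 + 3) / (4 - 3) := by gcongr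
    _ = 13 * M := by ring

/-- **Lewis' theorem** for real parts of entire functions: the first of the two is constant. -/
theorem re_eq_const_of_abs_posPart_sub_le {F G : ℂ → ℂ} (hF : Differentiable ℂ F)
    (hG : Differentiable ℂ G) {C : ℝ} (hC : 0 < C)
    (h1 : ∀ z, |max (F z).re 0 - max (G z).re 0| ≤ C)
    (h2 : ∀ z, -C ≤ max (F z).re (G z).re) : ∃ c : ℝ, ∀ z, (F z).re = c := by
  by_contra hne
  have hub : ∀ T : ℝ, ∃ p, T ≤ (F p).re := by
    by_contra! ⟨T, hT⟩
    exact hne (re_eq_const_of_forall_re_le hF fun z => (hT z).le)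
  obtain ⟨a₀, h0⟩ : ∃ a₀, (F a₀).re = 0 := by
    refine mem_range_of_exists_le_of_exists_ge (continuous_re.comp hF.continuous) ?_ (hub 0)
    by_contra! hpos
    obtain ⟨c, hc⟩ := re_eq_const_of_forall_re_le hF.neg (T := 0)
      fun z => by simpa using (hpos z).le
    exact hne ⟨-c, fun z => by simp [← hc z]⟩
  choose a c ha hT hK using fun n : ℕ =>
    exists_re_doubling hF h0 hub (T := n + 1 + C) (by positivity)
  set K : ℝ := 3 ^ 64 * 2 with hKdef
  have hK0 : 0 < K := by positivity
  clear_value K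
  set L : ℕ → ℝ := fun n => (F (a n + c n)).re with hL
  have hLn : ∀ n, n + 1 + C ≤ L n := hT
  have hLC : ∀ n, C < L n := fun n => by
    have := hLn n
    have : (0 : ℝ) ≤ n := n.cast_nonneg
    linarith
  have hL0 : ∀ n, 0 < L n := fun n => hC.trans (hLC n)
  have hL' : ∀ n, L n ≠ 0 := fun n => (hL0 n).ne'
  have hCL : Tendsto (fun n => C / L n) (hyperfilter ℕ : Filter ℕ) (nhds 0) := by
    have : Tendsto L atTop atTop := tendsto_atTop_mono (fun n => by
      have := hLn n
      linarith) tendsto_natCast_atTop_atTop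
    exact (this.const_div_atTop C).mono_left Nat.hyperfilter_le_atTop
  let f : ℕ → ℂ → ℂ := fun n w => (F (a n + c n * w) - F (a n)) / (L n : ℂ)
  let g : ℕ → ℂ → ℂ := fun n w =>
    (G (a n + c n * w) - ((G (a n + c n)).im : ℂ) * I) / (L n : ℂ)
  have hfre : ∀ n w, (f n w).re = (F (a n + c n * w)).re / L n := fun n w => by
    simp [f, div_ofReal_re, ha]
  have hgre : ∀ n w, (g n w).re = (G (a n + c n * w)).re / L n := fun n w => by
    simp [g, div_ofReal_re]
  have hfd : ∀ n, Differentiable ℂ (f n) := fun n => by fun_prop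
  have hgd : ∀ n, Differentiable ℂ (g n) := fun n => by fun_prop
  have hfK : ∀ n, ∀ w : ℂ, ‖w‖ < 8 → (f n w).re ≤ K := by
    intro n w hw
    rw [hfre, div_le_iff₀ (hL0 n), hKdef, mul_assoc]
    exact hK n w hw
  have hdiff : ∀ n w, |max (f n w).re 0 - max (g n w).re 0| ≤ C / L n := by
    intro n w
    have hmax : ∀ x : ℝ, max (x / L n) 0 = max x 0 / L n := fun x => by
      rw [← max_div_div_right (hL0 n).le, zero_div]
    rw [hfre, hgre, hmax, hmax, ← sub_div, abs_div, abs_of_pos (hL0 n)]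
    gcongr
    · exact (hL0 n).le
    · exact h1 _
  have hge : ∀ n w, -(C / L n) ≤ max (f n w).re (g n w).re := by
    intro n w
    rw [hfre, hgre, max_div_div_right (hL0 n).le, ← neg_div]
    gcongr
    · exact (hL0 n).le
    · exact h2 _
  have hCL1 : ∀ n, C / L n < 1 := fun n => (div_lt_one (hL0 n)).2 (hLC n)
  have hgK : ∀ n, ∀ w : ℂ, ‖w‖ < 8 → (g n w).re ≤ K + 1 := by
    intro n w hw
    have := (abs_le.1 (hdiff n w)).1
    have := hCL1 n
    have := max_le (hfK n w hw) hK0.le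
    linarith [le_max_left (g n w).re 0]
  have hf1 : ∀ n, (f n 1).re = 1 := fun n => by rw [hfre, mul_one]; exact div_self (hL' n)
  have hg1 : ∀ n, ‖g n 1‖ ≤ K + 1 := by
    intro n
    have him : (g n 1).im = 0 := by simp [g, div_ofReal_im]
    have hpos : 0 ≤ (g n 1).re := by
      have := (abs_le.1 (hdiff n 1)).2
      rw [hf1] at this
      by_contra! hneg
      rw [max_eq_right hneg.le] at this
      have := hCL1 n
      norm_num at *
      linarith
    have hre : g n 1 = ((g n 1).re : ℂ) := Complex.ext (by simp) (by simp [him])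
    rw [hre, norm_real, Real.norm_of_nonneg hpos]
    exact hgK n 1 (by norm_num)
  obtain ⟨f', hf'd, hf'⟩ := exists_tendstoLocallyUniformlyOn_of_norm_le (hyperfilter ℕ)
    (isOpen_ball : IsOpen (ball (0 : ℂ) 2)) (F := f) (M := 13 * K)
    (fun n => (hfd n).differentiableOn) fun n z hz =>
      norm_le_of_forall_ball_re_le (hfd n) (p := 0) hK0
        (fun w hw => hfK n w (by rw [mem_ball_zero_iff] at hw; linarith)) (by simp [f, hK0.le])
        (by rw [mem_ball] at hz; linarith)
  obtain ⟨g', hg'd, hg'⟩ := exists_tendstoLocallyUniformlyOn_of_norm_le (hyperfilter ℕ)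
    (isOpen_ball : IsOpen (ball (0 : ℂ) 2)) (F := g) (M := 13 * (K + 1))
    (fun n => (hgd n).differentiableOn) fun n z hz =>
      norm_le_of_forall_ball_re_le (hgd n) (p := 1) (by positivity)
        (fun w hw => hgK n w (by
          have := norm_le_norm_sub_add w 1
          rw [mem_ball, dist_eq_norm] at hw
          rw [norm_one] at this
          linarith)) (hg1 n)
        (by
          rw [mem_ball_zero_iff] at hz
          have := norm_sub_le z 1
          rw [norm_one] at this
          rw [dist_eq_norm]
          linarith)
  have hfr : ∀ z ∈ ball (0 : ℂ) 2,
      Tendsto (fun n => (f n z).re) (hyperfilter ℕ : Filter ℕ) (nhds (f' z).re) := fun z hz =>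
    (continuous_re.tendsto _).comp (hf'.tendsto_at hz)
  have hgr : ∀ z ∈ ball (0 : ℂ) 2,
      Tendsto (fun n => (g n z).re) (hyperfilter ℕ : Filter ℕ) (nhds (g' z).re) := fun z hz =>
    (continuous_re.tendsto _).comp (hg'.tendsto_at hz)
  have hm0 : (0 : ℂ) ∈ ball (0 : ℂ) 2 := by simp
  have hm1 : (1 : ℂ) ∈ ball (0 : ℂ) 2 := by simp
  refine false_of_max_re_eq isOpen_ball ((convex_ball _ _).isConnected ⟨0, hm0⟩) hf'd hg'd
    (fun z hz => ?_) (fun z hz => ?_) hm0 hm1 ?_ ?_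
  · have := le_of_tendsto_of_tendsto' (((hfr z hz).max tendsto_const_nhds).sub
      ((hgr z hz).max tendsto_const_nhds)).abs hCL fun n => hdiff n z
    exact sub_eq_zero.1 (abs_nonpos_iff.1 this)
  · have := le_of_tendsto_of_tendsto' hCL.neg ((hfr z hz).max (hgr z hz)) fun n => hge n z
    simpa using this
  · refine tendsto_nhds_unique (hfr 0 hm0) ?_
    simp [hfre, ha]
  · have : (f' 1).re = 1 := by
      refine tendsto_nhds_unique (hfr 1 hm1) ?_
      simp [hf1]
    linarith

/-- **Lewis' theorem.** If `u`, `v` are entire harmonic functions with `|u⁺ - v⁺| ≤ C` and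
`max(u, v) ≥ -C` everywhere, then `u` and `v` are constant. -/
theorem lewis_theorem
    (u v : ℂ → ℝ) (hu : HarmonicFn u) (hv : HarmonicFn v)
    (C : ℝ) (hC : 0 < C)
    (h1 : ∀ z, |max (u z) 0 - max (v z) 0| ≤ C)
    (h2 : ∀ z, -C ≤ max (u z) (v z)) :
    (∃ c : ℝ, ∀ z, u z = c) ∧ (∃ c : ℝ, ∀ z, v z = c) := by
  obtain ⟨F, hF, hFu⟩ := hu.exists_entire_re_eq
  obtain ⟨G, hG, hGv⟩ := hv.exists_entire_re_eq
  simp only [← hFu, ← hGv] at h1 h2 ⊢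
  exact ⟨re_eq_const_of_abs_posPart_sub_le hF hG hC h1 h2,
    re_eq_const_of_abs_posPart_sub_le hG hF hC (fun z => by rw [abs_sub_comm]; exact h1 z)
      fun z => by rw [max_comm]; exact h2 z⟩
end

section
/- Let g : ℂ → ℂ be a harmonic map such that D(R_g) contains no pair of antipodal points. Then there exist θ ∈ [0, 2π), ρ > 0 and a > 1 such that, writing f = e^{iθ}·g (which is again a harmonic map), R_f ⊆ D̄(0, ρ) ∪ ( { u + iv : |v| ≤ a|u| } \ { u + iv : |v| ≤ −u/a } ). -/
open Complex Metric Filter Set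

theorem mem_asympDirs_iff {R : Set ℂ} {ζ : ℂ} :
    ζ ∈ asympDirs R ↔ ‖ζ‖ = 1 ∧ ∀ δ > (0 : ℝ), ∃ w ∈ R, ∃ t : ℝ, 0 < t ∧ t < δ ∧
      dist ((t : ℂ) * w) ζ < δ := by
  refine and_congr_right fun _ => ⟨?_, fun h => ?_⟩
  · rintro ⟨w, hw, ε, hε, hε0, hlim⟩ δ hδ
    obtain ⟨n, hn₁, hn₂⟩ :=
      ((hε0.eventually_lt_const hδ).and (Metric.tendsto_nhds.1 hlim δ hδ)).exists
    exact ⟨w n, hw n, ε n, hε n, hn₁, hn₂⟩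
  · choose w hw t ht htlt hd using fun n : ℕ => h (1 / ((n : ℝ) + 1)) (by positivity)
    refine ⟨w, hw, t, ht, ?_, ?_⟩
    · exact squeeze_zero (fun n => (ht n).le) (fun n => (htlt n).le)
        tendsto_one_div_add_atTop_nhds_zero_nat
    · exact tendsto_iff_dist_tendsto_zero.2 <| squeeze_zero (fun _ => dist_nonneg)
        (fun n => (hd n).le) tendsto_one_div_add_atTop_nhds_zero_nat

theorem isClosed_asympDirs (R : Set ℂ) : IsClosed (asympDirs R) := by
  refine isClosed_of_closure_subset fun ζ hζ => mem_asympDirs_iff.2 ⟨?_, fun δ hδ => ?_⟩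
  · have hsub : asympDirs R ⊆ {z : ℂ | ‖z‖ = 1} := fun z hz => hz.1
    exact closure_minimal hsub (isClosed_eq continuous_norm continuous_const) hζ
  · obtain ⟨ξ, hξ, hd⟩ := Metric.mem_closure_iff.1 hζ (δ / 2) (half_pos hδ)
    obtain ⟨w, hw, t, ht, htlt, hd'⟩ := (mem_asympDirs_iff.1 hξ).2 (δ / 2) (half_pos hδ)
    refine ⟨w, hw, t, ht, by linarith, ?_⟩
    have := dist_triangle ((t : ℂ) * w) ξ ζ
    rw [dist_comm ξ ζ] at this
    linarith

/-- A closed set without antipodal pairs misses some antipodal pair of the unit circle, by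
connectedness of the circle. -/
theorem exists_antipodal_notMem {D : Set ℂ} (hD : IsClosed D)
    (hno : ¬ ∃ ζ : ℂ, ζ ∈ D ∧ -ζ ∈ D) : ∃ p : ℂ, ‖p‖ = 1 ∧ p ∉ D ∧ -p ∉ D := by
  by_contra! h
  have hcon : IsPreconnected (Metric.sphere (0 : ℂ) 1) :=
    isPreconnected_sphere (by rw [Complex.rank_real_complex]; norm_num) 0 1
  have hcover : Metric.sphere (0 : ℂ) 1 ⊆ D ∪ {z | -z ∈ D} := fun z hz => by
    by_cases hzD : z ∈ D
    · exact Or.inl hzD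
    · exact Or.inr (h z (by simpa using hz) hzD)
  have key : ∃ q ∈ Metric.sphere (0 : ℂ) 1, q ∈ D := by
    rcases hcover (show (1 : ℂ) ∈ Metric.sphere (0 : ℂ) 1 by simp) with h1 | h1
    · exact ⟨1, by simp, h1⟩
    · exact ⟨-1, by simp, h1⟩
  obtain ⟨q, hq, hqD⟩ := key
  obtain ⟨z, -, hz⟩ := isPreconnected_closed_iff.1 hcon D {z | -z ∈ D} hD
    (hD.preimage continuous_neg) hcover ⟨q, hq, hqD⟩
    ⟨-q, by simpa using hq, by simpa using hqD⟩
  exact hno ⟨z, hz⟩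

theorem exists_three_directions_notMem {D : Set ℂ} (hD : IsClosed D)
    (hno : ¬ ∃ ζ : ℂ, ζ ∈ D ∧ -ζ ∈ D) :
    ∃ p : ℂ, ‖p‖ = 1 ∧ p ∉ D ∧ -p ∉ D ∧ I * p ∉ D := by
  obtain ⟨p, hp, h₁, h₂⟩ := exists_antipodal_notMem hD hno
  by_cases h : I * p ∈ D
  · refine ⟨-p, by simpa using hp, h₂, by simpa using h₁, fun h' => hno ⟨I * p, h, ?_⟩⟩
    simpa using h'
  · exact ⟨p, hp, h₁, h₂, h⟩

theorem exists_exp_mul_I_eq {c : ℂ} (hc : ‖c‖ = 1) :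
    ∃ θ : ℝ, 0 ≤ θ ∧ θ < 2 * Real.pi ∧ Complex.exp (θ * I) = c := by
  have hexp : Complex.exp (c.arg * I) = c := by
    simpa [hc] using Complex.norm_mul_exp_arg_mul_I c
  have hpi := Real.pi_pos
  rcases le_or_gt 0 c.arg with h | h
  · exact ⟨c.arg, h, by linarith [Complex.arg_le_pi c], hexp⟩
  · refine ⟨c.arg + 2 * Real.pi, by linarith [Complex.neg_pi_lt_arg c], by linarith, ?_⟩
    push_cast
    rw [add_mul, Complex.exp_add, Complex.exp_two_pi_mul_I, mul_one, hexp]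

theorem min_abs_re_le_of_notMem_cross {w : ℂ} {a : ℝ} (ha : 0 < a)
    (h : w ∉ {w : ℂ | |w.im| ≤ a * |w.re|} \ {w : ℂ | |w.im| ≤ -w.re / a}) :
    min |w.re| (|w.im| + max w.re 0) ≤ ‖w‖ / a := by
  rw [Set.mem_sdiff, not_and_or, not_not] at h
  rcases h with h | h
  · refine (min_le_left _ _).trans ?_
    rw [le_div_iff₀ ha]
    have hlt : a * |w.re| < |w.im| := not_le.1 h
    linarith [Complex.abs_im_le_norm w]
  · replace h : |w.im| ≤ -w.re / a := h
    refine (min_le_right _ _).trans ?_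
    have h0 : 0 ≤ -w.re / a := (abs_nonneg _).trans h
    have hre : w.re ≤ 0 := by
      have := (le_div_iff₀ ha).1 h0
      linarith
    rw [max_eq_right hre, add_zero]
    refine h.trans (div_le_div_of_nonneg_right ?_ ha.le)
    exact (neg_le_abs _).trans (Complex.abs_re_le_norm w)

theorem eq_of_min_abs_re_le_zero {ξ : ℂ} (hξ : ‖ξ‖ = 1)
    (h : min |ξ.re| (|ξ.im| + max ξ.re 0) ≤ 0) : ξ = I ∨ ξ = -I ∨ ξ = -1 := by
  have hsq : ξ.re * ξ.re + ξ.im * ξ.im = 1 := by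
    rw [← Complex.normSq_apply, Complex.normSq_eq_norm_sq, hξ, one_pow]
  rcases min_le_iff.1 h with h | h
  · have hre : ξ.re = 0 := abs_nonpos_iff.1 h
    have him : ξ.im * ξ.im = 1 := by simpa [hre] using hsq
    rcases mul_self_eq_one_iff.1 him with him | him
    · exact Or.inl (Complex.ext (by simp [hre]) (by simp [him]))
    · exact Or.inr (Or.inl (Complex.ext (by simp [hre]) (by simp [him])))
  · have h₁ := abs_nonneg ξ.im
    have h₂ := le_max_right ξ.re 0
    have h₃ := le_max_left ξ.re 0
    have him : ξ.im = 0 := abs_nonpos_iff.1 (by linarith)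
    have hre : ξ.re * ξ.re = 1 := by simpa [him] using hsq
    rcases mul_self_eq_one_iff.1 hre with hre | hre
    · linarith
    · exact Or.inr (Or.inr (Complex.ext (by simp [hre]) (by simp [him])))

/-- If a rotated set has none of the asymptotic directions `I`, `-I`, `-1`, then outside a disc it
lies in the cross region. -/
theorem exists_subset_closedBall_union_cross {R : Set ℂ} {c : ℂ} (hc : ‖c‖ = 1)
    (hI : c⁻¹ * I ∉ asympDirs R) (hI' : c⁻¹ * -I ∉ asympDirs R)
    (h1 : c⁻¹ * -1 ∉ asympDirs R) :
    ∃ ρ a : ℝ, 0 < ρ ∧ 1 < a ∧ ∀ w ∈ R, c * w ∈ Metric.closedBall (0 : ℂ) ρ ∪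
      ({w : ℂ | |w.im| ≤ a * |w.re|} \ {w : ℂ | |w.im| ≤ -w.re / a}) := by
  by_contra! h
  have hc0 : c ≠ 0 := norm_ne_zero_iff.1 (by simp [hc])
  choose w hw hnot using fun n : ℕ =>
    h ((n : ℝ) + 1) ((n : ℝ) + 2) (by positivity) (by linarith [n.cast_nonneg (α := ℝ)])
  have hball (n : ℕ) : (n : ℝ) + 1 < ‖w n‖ := by
    simpa [hc] using fun hb => hnot n (Or.inl hb)
  have hpos (n : ℕ) : 0 < ‖w n‖ := lt_trans (by positivity) (hball n)
  set x : ℕ → ℂ := fun n => ((‖w n‖⁻¹ : ℝ) : ℂ) * (c * w n) with hx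
  have hxn (n : ℕ) : ‖x n‖ = 1 := by
    simp [hx, hc, (hpos n).ne']
  have hxmin (n : ℕ) : min |(x n).re| (|(x n).im| + max (x n).re 0) ≤ 1 / ((n : ℝ) + 1) := by
    have hle := min_abs_re_le_of_notMem_cross (by positivity) fun hb => hnot n (Or.inr hb)
    have hr : 0 < ‖w n‖⁻¹ := inv_pos.2 (hpos n)
    have hscale : min |(x n).re| (|(x n).im| + max (x n).re 0) =
        ‖w n‖⁻¹ * min |(c * w n).re| (|(c * w n).im| + max (c * w n).re 0) := by
      rw [mul_min_of_nonneg _ _ hr.le, mul_add, mul_max_of_nonneg _ _ hr.le, mul_zero]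
      simp only [hx, Complex.re_ofReal_mul, Complex.im_ofReal_mul, abs_mul, abs_of_pos hr]
    rw [hscale]
    calc _ ≤ ‖w n‖⁻¹ * (‖c * w n‖ / ((n : ℝ) + 2)) := mul_le_mul_of_nonneg_left hle hr.le
      _ = 1 / ((n : ℝ) + 2) := by
        have := (hpos n).ne'
        rw [norm_mul, hc, one_mul]
        field_simp
      _ ≤ 1 / ((n : ℝ) + 1) := by gcongr; norm_num
  obtain ⟨ξ, hξ, φ, hφ, hlim⟩ := (isCompact_sphere (0 : ℂ) 1).tendsto_subseq
    (x := x) fun n => by simpa using hxn n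
  replace hξ : ‖ξ‖ = 1 := by simpa using hξ
  have hmin : min |ξ.re| (|ξ.im| + max ξ.re 0) ≤ 0 := by
    have hcont : Continuous fun z : ℂ => min |z.re| (|z.im| + max z.re 0) := by fun_prop
    exact le_of_tendsto_of_tendsto' ((hcont.tendsto ξ).comp hlim)
      (tendsto_one_div_add_atTop_nhds_zero_nat.comp hφ.tendsto_atTop) fun n => hxmin (φ n)
  have hmem : c⁻¹ * ξ ∈ asympDirs R := by
    refine ⟨by simp [hc, hξ], fun n => w (φ n), fun n => hw _, fun n => ‖w (φ n)‖⁻¹,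
      fun n => inv_pos.2 (hpos _), ?_, ?_⟩
    · have hto : Tendsto (fun n => ‖w n‖) atTop atTop :=
        tendsto_atTop_mono (fun n => by linarith [hball n]) tendsto_natCast_atTop_atTop
      exact (tendsto_inv_atTop_zero.comp hto).comp hφ.tendsto_atTop
    · refine (hlim.const_mul c⁻¹).congr fun n => ?_
      simp only [hx, Function.comp_apply]
      field_simp
  rcases eq_of_min_abs_re_le_zero hξ hmin with rfl | rfl | rfl
  exacts [hI hmem, hI' hmem, h1 hmem]

/-- **Corollary 2.8.** If `g` is a harmonic map whose asymptotic directions contain no antipodal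
pair, then after a rotation `f = e^{iθ}·g` the range of `f` is, outside a disc, contained in
`{u + iv : |v| ≤ a|u|} \ {u + iv : |v| ≤ -u/a}` for some `a > 1`. -/
theorem rotated_range_in_cross
    (u v : ℂ → ℝ) (hu : HarmonicFn u) (hv : HarmonicFn v)
    (g : ℂ → ℂ) (hg : ∀ z, g z = (u z : ℂ) + (v z : ℂ) * Complex.I)
    (hno : ¬ ∃ ζ : ℂ, ζ ∈ asympDirs (Set.range g) ∧ -ζ ∈ asympDirs (Set.range g)) :
    ∃ θ ρ a : ℝ, 0 ≤ θ ∧ θ < 2 * Real.pi ∧ 0 < ρ ∧ 1 < a ∧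
      Set.range (fun z => Complex.exp (θ * Complex.I) * g z) ⊆
        Metric.closedBall (0 : ℂ) ρ ∪
          ({w : ℂ | |w.im| ≤ a * |w.re|} \ {w : ℂ | |w.im| ≤ -w.re / a}) := by
  obtain ⟨p, hp, h₁, h₂, h₃⟩ := exists_three_directions_notMem (isClosed_asympDirs _) hno
  have hp0 : p ≠ 0 := norm_ne_zero_iff.1 (by simp [hp])
  obtain ⟨θ, hθ, hθ', hexp⟩ := exists_exp_mul_I_eq (c := I / p) (by simp [hp])
  obtain ⟨ρ, a, hρ, ha, hsub⟩ := exists_subset_closedBall_union_cross (R := Set.range g)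
    (c := I / p) (by simp [hp])
    (by convert h₁ using 1; field_simp)
    (by convert h₂ using 1; field_simp)
    (by convert h₃ using 1; simp [mul_comm])
  refine ⟨θ, ρ, a, hθ, hθ', hρ, ha, ?_⟩
  rintro _ ⟨z, rfl⟩
  simpa only [hexp] using hsub (g z) ⟨z, rfl⟩
end

section
/- Let u be harmonic in the open disc D(z₀, r) and continuous on the closed disc D̄(z₀, r), with u(z₀) = 0. Then M(|u|, z₀, (2/3)r) ≤ 4·M(u, z₀, r). -/
open Complex Metric Filter Set

/-- On an open set, vanishing of the Laplacian computed from derivatives within the set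
agrees with Mathlib's notion of harmonicity. -/
theorem HarmonicOnSet.harmonicOnNhd {u : ℂ → ℝ} {s : Set ℂ} (hu : HarmonicOnSet u s)
    (hs : IsOpen s) : InnerProductSpace.HarmonicOnNhd u s := by
  intro x hx
  refine ⟨hu.1.contDiffAt (hs.mem_nhds hx), ?_⟩
  filter_upwards [hs.mem_nhds hx] with y hy
  have h := hu.2 y hy
  rw [iteratedFDerivWithin_of_isOpen 2 hs hy] at h
  simpa [InnerProductSpace.laplacian_eq_iteratedFDeriv_complexPlane] using h

/-- Borel–Carathéodory estimate for a harmonic function vanishing at the centre of a disc. -/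
theorem InnerProductSpace.HarmonicOnNhd.abs_le_of_le {u : ℂ → ℝ} {c z : ℂ} {R M : ℝ}
    (hu : InnerProductSpace.HarmonicOnNhd u (ball c R)) (hM : 0 < M)
    (hle : ∀ w ∈ ball c R, u w ≤ M) (h0 : u c = 0) (hz : z ∈ ball c R) :
    |u z| ≤ 2 * M * ‖z - c‖ / (R - ‖z - c‖) := by
  obtain ⟨F, hF, hFu⟩ := hu.exists_analyticOnNhd_ball_re_eq
  have hR : 0 < R := pos_of_mem_ball hz
  have hmaps : MapsTo (fun w => c + w) (ball 0 R) (ball c R) := by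
    intro w hw
    simpa [mem_ball_iff_norm] using hw
  have hre : ∀ w ∈ ball c R, (F w - F c).re = u w := by
    intro w hw
    have hw' : (F w).re = u w := hFu hw
    have hc' : (F c).re = u c := hFu (mem_ball_self hR)
    rw [Complex.sub_re, hw', hc', h0, sub_zero]
  have hbound := Complex.borelCaratheodory_zero (f := fun w => F (c + w) - F c) (z := z - c) hM
    ((hF.differentiableOn.comp (by fun_prop) hmaps).sub_const _)
    (fun w hw => (hre _ (hmaps hw)).trans_le (hle _ (hmaps hw))) hR
    (by simpa [← dist_eq_norm] using hz) (by simp)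
  rw [add_sub_cancel] at hbound
  rw [← hre z hz]
  exact (Complex.abs_re_le_norm _).trans hbound

/-- **Lemma 3.3.** If `u` is harmonic in `D(z₀,r)`, continuous on `D̄(z₀,r)` and `u(z₀) = 0`,
then `M(|u|, z₀, (2/3)r) ≤ 4·M(u, z₀, r)`. -/
theorem abs_sup_bound
    (z₀ : ℂ) (r : ℝ) (hr : 0 < r) (u : ℂ → ℝ)
    (hu : HarmonicOnSet u (Metric.ball z₀ r))
    (hc : ContinuousOn u (Metric.closedBall z₀ r))
    (h0 : u z₀ = 0) :
    supOn (fun z => |u z|) z₀ (2 / 3 * r) ≤ 4 * supOn u z₀ r := by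
  have hbdd : BddAbove (u '' closedBall z₀ r) := (isCompact_closedBall z₀ r).bddAbove_image hc
  have hle : ∀ w ∈ closedBall z₀ r, u w ≤ supOn u z₀ r :=
    fun w hw => le_csSup hbdd (mem_image_of_mem u hw)
  have hnonneg : 0 ≤ supOn u z₀ r := h0 ▸ hle z₀ (mem_closedBall_self hr.le)
  refine csSup_le ((nonempty_closedBall.2 (by positivity)).image _) ?_
  rintro _ ⟨z, hz, rfl⟩
  rw [mem_closedBall_iff_norm] at hz
  have hpos : 0 < r - ‖z - z₀‖ := by linarith
  refine le_of_forall_pos_le_add fun ε hε => ?_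
  have hM : 0 < supOn u z₀ r + ε / 4 := by positivity
  calc |u z| ≤ 2 * (supOn u z₀ r + ε / 4) * ‖z - z₀‖ / (r - ‖z - z₀‖) :=
        (hu.harmonicOnNhd isOpen_ball).abs_le_of_le hM
          (fun w hw => (hle w (ball_subset_closedBall hw)).trans (by linarith)) h0
          (mem_ball_iff_norm.2 (by linarith))
    _ ≤ 4 * supOn u z₀ r + ε := by
        rw [div_le_iff₀ hpos]
        nlinarith [mul_nonneg hM.le (sub_nonneg.2 hz)]
end
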